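/- arXiv:2305.03543 — 4 statements merged into one kernel-verified Lean document; each statement's English description precedes it below -/
import Mathlib

section
/- For every K > 0 there exist C > 0 and n_0 such that for all n ≥ n_0: if G ∼ G(2n,1/2), then the probability that there exists a subset S ⊆ [2n] with Σ_{v∈[2n]} (deg(v,S) − |S|/2)² ≥ C·n² is at most exp(−K·n). -/
/-- The probability, under the uniform measure on labeled graphs on `Fin n`
(equivalently under `G(n,1/2)`), of a graph property `P`. -/
noncomputable def graphProb (n : ℕ) (P : SimpleGraph (Fin n) → Prop) : ℝ :=
  (Nat.card {G : SimpleGraph (Fin n) // P G} : ℝ) / 2 ^ n.choose 2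

/-- `deg(v,S)`: the number of neighbors of `v` inside the vertex set `S`. -/
noncomputable def degIn {n : ℕ} (G : SimpleGraph (Fin n)) (v : Fin n)
    (S : Finset (Fin n)) : ℕ :=
  Nat.card {w : Fin n // w ∈ S ∧ G.Adj v w}

/-- One step of the exponential-square moment bound for a signed sum. -/
lemma exp_sq_add_exp_sq_le {t c : ℝ} (ht : 2 < t) (hc : |c| ≤ 1) (x : ℝ) :
    Real.exp ((x - c) ^ 2 / t) + Real.exp ((x + c) ^ 2 / t) ≤
      2 * Real.exp (1 / t) * Real.exp (x ^ 2 / (t - 2)) := by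
  have ht0 : 0 < t := by linarith
  have ht2 : 0 < t - 2 := by linarith
  have hc2 : c ^ 2 ≤ 1 := (sq_le_one_iff_abs_le_one c).2 hc
  have hsum : Real.exp ((x - c) ^ 2 / t) + Real.exp ((x + c) ^ 2 / t) =
      2 * Real.exp ((x ^ 2 + c ^ 2) / t) * Real.cosh (2 * x * c / t) := by
    have h₁ : (x - c) ^ 2 / t = (x ^ 2 + c ^ 2) / t + -(2 * x * c / t) := by ring
    have h₂ : (x + c) ^ 2 / t = (x ^ 2 + c ^ 2) / t + 2 * x * c / t := by ring
    rw [h₁, h₂, Real.exp_add, Real.exp_add, Real.cosh_eq]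
    ring
  have hquad : (x ^ 2 + c ^ 2) / t + (2 * x * c / t) ^ 2 / 2 ≤ 1 / t + x ^ 2 / (t - 2) := by
    have h₁ : (x ^ 2 + c ^ 2) / t ≤ (x ^ 2 + 1) / t := by gcongr
    have h₂ : (2 * x * c / t) ^ 2 / 2 ≤ 2 * x ^ 2 / t ^ 2 := by
      have : (2 * x * c / t) ^ 2 / 2 = 2 * x ^ 2 / t ^ 2 * c ^ 2 := by ring
      rw [this]
      exact mul_le_of_le_one_right (by positivity) hc2
    have h₃ : 1 / t + 2 / t ^ 2 ≤ 1 / (t - 2) := by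
      have : 1 / t + 2 / t ^ 2 = (t + 2) / t ^ 2 := by field_simp
      rw [this, div_le_div_iff₀ (by positivity) ht2]
      nlinarith
    calc (x ^ 2 + c ^ 2) / t + (2 * x * c / t) ^ 2 / 2
        ≤ (x ^ 2 + 1) / t + 2 * x ^ 2 / t ^ 2 := add_le_add h₁ h₂
      _ = 1 / t + x ^ 2 * (1 / t + 2 / t ^ 2) := by ring
      _ ≤ 1 / t + x ^ 2 * (1 / (t - 2)) := by gcongr
      _ = 1 / t + x ^ 2 / (t - 2) := by ring
  rw [hsum]
  calc 2 * Real.exp ((x ^ 2 + c ^ 2) / t) * Real.cosh (2 * x * c / t)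
      ≤ 2 * Real.exp ((x ^ 2 + c ^ 2) / t) * Real.exp ((2 * x * c / t) ^ 2 / 2) := by
        gcongr
        exact Real.cosh_le_exp_half_sq _
    _ = 2 * Real.exp ((x ^ 2 + c ^ 2) / t + (2 * x * c / t) ^ 2 / 2) := by
        rw [Real.exp_add]; ring
    _ ≤ 2 * Real.exp (1 / t + x ^ 2 / (t - 2)) := by gcongr
    _ = 2 * Real.exp (1 / t) * Real.exp (x ^ 2 / (t - 2)) := by
        rw [Real.exp_add]; ring

/-- Exponential-square moment bound for a signed sum over a finite set with uniform signs. -/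
lemma sum_powerset_exp_sq_le {ι : Type*} [DecidableEq ι] {c : ι → ℝ} (hc : ∀ i, |c i| ≤ 1)
    {s : ℝ} (hs : 0 < s) (U : Finset ι) {t : ℝ} (ht : 2 * (U.card : ℝ) + s ≤ t) :
    ∑ T ∈ U.powerset, Real.exp ((∑ i ∈ U, c i * if i ∈ T then 1 else -1) ^ 2 / t) ≤
      2 ^ U.card * Real.exp (U.card / s) := by
  induction U using Finset.induction_on generalizing t with
  | empty => simp
  | insert a U ha ih =>
    rw [Finset.card_insert_of_notMem ha] at ht ⊢
    push_cast at ht ⊢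
    have hU : (0 : ℝ) ≤ U.card := Nat.cast_nonneg _
    have hstep : ∀ T ∈ U.powerset,
        Real.exp ((∑ i ∈ insert a U, c i * if i ∈ T then 1 else -1) ^ 2 / t) +
          Real.exp ((∑ i ∈ insert a U, c i * if i ∈ insert a T then 1 else -1) ^ 2 / t) ≤
        2 * Real.exp (1 / t) *
          Real.exp ((∑ i ∈ U, c i * if i ∈ T then 1 else -1) ^ 2 / (t - 2)) := by
      intro T hT
      have haT : a ∉ T := fun h => ha (Finset.mem_powerset.1 hT h)
      have hcongr : ∑ i ∈ U, c i * (if i ∈ insert a T then 1 else -1) =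
          ∑ i ∈ U, c i * (if i ∈ T then 1 else -1) := by
        refine Finset.sum_congr rfl fun i hi => ?_
        have : i ≠ a := fun h => ha (h ▸ hi)
        simp [Finset.mem_insert, this]
      rw [Finset.sum_insert ha, Finset.sum_insert ha, hcongr, if_neg haT,
        if_pos (Finset.mem_insert_self a T)]
      convert exp_sq_add_exp_sq_le (t := t) (by linarith) (hc a)
        (∑ i ∈ U, c i * if i ∈ T then 1 else -1) using 4 <;> ring
    rw [Finset.sum_powerset_insert ha, ← Finset.sum_add_distrib]
    refine (Finset.sum_le_sum hstep).trans ?_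
    rw [← Finset.mul_sum]
    calc _ ≤ 2 * Real.exp (1 / s) * (2 ^ U.card * Real.exp (U.card / s)) := by
          gcongr
          · linarith
          · exact ih (by linarith)
      _ = 2 ^ (U.card + 1) * Real.exp ((U.card + 1) / s) := by
          rw [add_div, Real.exp_add]; ring

/-- A sum of products over an injectively parametrized family of tuples of subsets is at most
the product of the sums over all subsets. -/
lemma sum_prod_le_prod_sum_powerset {α ι κ : Type*} [Fintype α] [Fintype ι] [DecidableEq ι]
    [DecidableEq κ] {code : α → ι → Finset κ} (hcode : Function.Injective code)
    {U : ι → Finset κ} (hU : ∀ x i, code x i ⊆ U i) {h : ι → Finset κ → ℝ}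
    (hh : ∀ i T, 0 ≤ h i T) :
    ∑ x, ∏ i, h i (code x i) ≤ ∏ i, ∑ T ∈ (U i).powerset, h i T := by
  rw [Finset.prod_univ_sum]
  refine (Finset.sum_map Finset.univ ⟨code, hcode⟩ fun p => ∏ i, h i (p i)).symm.trans_le ?_
  refine Finset.sum_le_sum_of_subset_of_nonneg ?_ fun p _ _ =>
    Finset.prod_nonneg fun i _ => hh i _
  intro p hp
  obtain ⟨x, -, rfl⟩ := Finset.mem_map.1 hp
  exact Fintype.mem_piFinset.2 fun i => Finset.mem_powerset.2 (hU x i)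

open Classical in
/-- Exponential-square moment bound for the signed degrees of a graph, each taken over a
set `U v`, where every pair of distinct vertices is covered by exactly one of the `U v`. -/
lemma sum_graph_exp_sum_sq_le {N : ℕ} (hN : 0 < N) (U : Fin N → Finset (Fin N))
    (hcover : ∀ v w, v ≠ w → w ∈ U v ∨ v ∈ U w)
    (hcard : ∑ v, (U v).card = N.choose 2) {c : Fin N → ℝ} (hc : ∀ i, |c i| ≤ 1) :
    ∑ G : SimpleGraph (Fin N),
      Real.exp ((∑ v, (∑ w ∈ U v, c w * if G.Adj v w then 1 else -1) ^ 2) / (4 * N)) ≤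
      2 ^ N.choose 2 * Real.exp (N / 2) := by
  have hN' : (0 : ℝ) < N := by exact_mod_cast hN
  let code : SimpleGraph (Fin N) → Fin N → Finset (Fin N) :=
    fun G v => (U v).filter (G.Adj v)
  have hcode : Function.Injective code := by
    intro G H h
    have key : ∀ v w, w ∈ U v → (G.Adj v w ↔ H.Adj v w) := by
      intro v w hw
      have := Finset.ext_iff.1 (congrFun h v) w
      simpa [code, hw] using this
    ext v w
    by_cases hvw : v = w
    · simp [hvw]
    · rcases hcover v w hvw with hw | hv
      · exact key v w hw
      · rw [G.adj_comm, H.adj_comm]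
        exact key w v hv
  let h : Fin N → Finset (Fin N) → ℝ := fun v T =>
    Real.exp ((∑ w ∈ U v, c w * if w ∈ T then 1 else -1) ^ 2 / (4 * N))
  have hprod : ∀ G : SimpleGraph (Fin N),
      Real.exp ((∑ v, (∑ w ∈ U v, c w * if G.Adj v w then 1 else -1) ^ 2) / (4 * N)) =
        ∏ v, h v (code G v) := by
    intro G
    rw [Finset.sum_div, Real.exp_sum]
    refine Finset.prod_congr rfl fun v _ => ?_
    simp only [h]
    congr 3
    refine Finset.sum_congr rfl fun w hw => ?_
    simp [code, hw]
  calc ∑ G : SimpleGraph (Fin N),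
      Real.exp ((∑ v, (∑ w ∈ U v, c w * if G.Adj v w then 1 else -1) ^ 2) / (4 * N))
      = ∑ G : SimpleGraph (Fin N), ∏ v, h v (code G v) :=
        Finset.sum_congr rfl fun G _ => hprod G
    _ ≤ ∏ v, ∑ T ∈ (U v).powerset, h v T :=
        sum_prod_le_prod_sum_powerset hcode (fun G v => Finset.filter_subset _ _)
          fun v T => (Real.exp_pos _).le
    _ ≤ ∏ v : Fin N, (2 ^ (U v).card * Real.exp (1 / 2)) := by
        refine Finset.prod_le_prod
          (fun v _ => Finset.sum_nonneg fun T _ => (Real.exp_pos _).le) fun v _ => ?_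
        have hle : ((U v).card : ℝ) ≤ N := by
          exact_mod_cast (Finset.card_le_univ (U v)).trans_eq (Fintype.card_fin N)
        refine (sum_powerset_exp_sq_le hc (s := 2 * N) (by positivity) (U v)
          (by linarith)).trans ?_
        refine mul_le_mul_of_nonneg_left (Real.exp_le_exp.2 ?_) (by positivity)
        rw [div_le_div_iff₀ (by positivity) (by norm_num)]
        linarith
    _ = 2 ^ N.choose 2 * Real.exp (N / 2) := by
        rw [Finset.prod_mul_distrib, Finset.prod_pow_eq_pow_sum, hcard, Finset.prod_const,
          ← Real.exp_nat_mul]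
        simp [div_eq_mul_inv]

open Classical in
/-- The centred degree as a signed sum over the vertices below and above `v`. -/
lemma degIn_sub_half_card {N : ℕ} (G : SimpleGraph (Fin N)) (v : Fin N) (S : Finset (Fin N)) :
    (degIn G v S : ℝ) - (S.card : ℝ) / 2 =
      ((∑ w ∈ Finset.Iio v, (if w ∈ S then 1 else 0) * if G.Adj v w then 1 else -1) +
        (∑ w ∈ Finset.Ioi v, (if w ∈ S then 1 else 0) * if G.Adj v w then 1 else -1) -
        if v ∈ S then 1 else 0) / 2 := by
  have hdeg : (degIn G v S : ℝ) = ∑ w, if w ∈ S ∧ G.Adj v w then (1 : ℝ) else 0 := by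
    rw [degIn, Nat.card_eq_fintype_card, Fintype.card_subtype, Finset.sum_boole]
  have hS : (S.card : ℝ) = ∑ w, if w ∈ S then (1 : ℝ) else 0 := by
    rw [Finset.sum_boole]; simp
  have hsplit : ∀ f : Fin N → ℝ,
      ∑ w, f w = ∑ w ∈ Finset.Iio v, f w + ∑ w ∈ Finset.Ioi v, f w + f v := by
    intro f
    have hu : (Finset.univ : Finset (Fin N)) =
        insert v (Finset.Iio v ∪ Finset.Ioi v) := by
      ext w
      simp only [Finset.mem_univ, Finset.mem_insert, Finset.mem_union, Finset.mem_Iio,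
        Finset.mem_Ioi, true_iff]
      rcases lt_trichotomy w v with h | h | h <;> simp [h]
    have hd : Disjoint (Finset.Iio v) (Finset.Ioi v) := by
      rw [Finset.disjoint_left]
      intro w h₁ h₂
      exact lt_asymm (Finset.mem_Iio.1 h₁) (Finset.mem_Ioi.1 h₂)
    rw [hu, Finset.sum_insert (by simp), Finset.sum_union hd]
    ring
  have hsigned : (degIn G v S : ℝ) - (S.card : ℝ) / 2 =
      (∑ w, (if w ∈ S then (1 : ℝ) else 0) * if G.Adj v w then 1 else -1) / 2 := by
    rw [hdeg, hS, Finset.sum_div, Finset.sum_div, ← Finset.sum_sub_distrib]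
    refine Finset.sum_congr rfl fun w _ => ?_
    by_cases h₁ : w ∈ S <;> by_cases h₂ : G.Adj v w <;> simp [h₁, h₂] <;> norm_num
  rw [hsigned, hsplit]
  simp [sub_eq_add_neg]

open Classical in
/-- Exponential moment bound for the degree variance with respect to a fixed set `S`. -/
lemma sum_graph_exp_degree_variance_le {N : ℕ} (hN : 0 < N) (S : Finset (Fin N)) :
    ∑ G : SimpleGraph (Fin N),
      Real.exp ((∑ v, ((degIn G v S : ℝ) - (S.card : ℝ) / 2) ^ 2) / (8 * N)) ≤
      2 ^ N.choose 2 * Real.exp (N / 2 + 2) := by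
  have hN' : (0 : ℝ) < N := by exact_mod_cast hN
  let c : Fin N → ℝ := fun w => if w ∈ S then 1 else 0
  have hc : ∀ i, |c i| ≤ 1 := by
    intro i
    simp only [c]
    split_ifs <;> simp
  have hid : ∑ i ∈ Finset.range N, i = N.choose 2 := by
    rw [Finset.sum_range_id, Nat.choose_two_right]
  have hlow := sum_graph_exp_sum_sq_le hN (fun v => Finset.Iio v)
    (fun v w h => by simpa using h.lt_or_gt.symm)
    (by simpa [Fin.sum_univ_eq_sum_range (fun i => i)] using hid) hc
  have hupp := sum_graph_exp_sum_sq_le hN (fun v => Finset.Ioi v)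
    (fun v w h => by simpa using h.lt_or_gt)
    (by
      simp only [Fin.card_Ioi]
      rw [Fin.sum_univ_eq_sum_range (fun i => N - 1 - i) N, Finset.sum_range_reflect (fun i => i)]
      exact hid) hc
  let A : SimpleGraph (Fin N) → ℝ := fun G =>
    ∑ v, (∑ w ∈ Finset.Iio v, c w * if G.Adj v w then 1 else -1) ^ 2
  let B : SimpleGraph (Fin N) → ℝ := fun G =>
    ∑ v, (∑ w ∈ Finset.Ioi v, c w * if G.Adj v w then 1 else -1) ^ 2
  have hle : ∀ G : SimpleGraph (Fin N),
      ∑ v, ((degIn G v S : ℝ) - (S.card : ℝ) / 2) ^ 2 ≤ A G + B G + N := by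
    intro G
    have hone : (N : ℝ) = ∑ _v : Fin N, (1 : ℝ) := by simp
    rw [hone]
    simp only [A, B]
    rw [← Finset.sum_add_distrib, ← Finset.sum_add_distrib]
    refine Finset.sum_le_sum fun v _ => ?_
    rw [degIn_sub_half_card]
    change (((∑ w ∈ Finset.Iio v, c w * if G.Adj v w then 1 else -1) +
      (∑ w ∈ Finset.Ioi v, c w * if G.Adj v w then 1 else -1) - c v) / 2) ^ 2 ≤ _
    have hcv : c v ^ 2 ≤ 1 := (sq_le_one_iff_abs_le_one _).2 (hc v)
    generalize (∑ w ∈ Finset.Iio v, c w * if G.Adj v w then (1 : ℝ) else -1) = x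
    generalize (∑ w ∈ Finset.Ioi v, c w * if G.Adj v w then (1 : ℝ) else -1) = y
    nlinarith [sq_nonneg (x - y), sq_nonneg (x + c v), sq_nonneg (y + c v), sq_nonneg x,
      sq_nonneg y]
  have hexp : ∀ G : SimpleGraph (Fin N),
      Real.exp ((∑ v, ((degIn G v S : ℝ) - (S.card : ℝ) / 2) ^ 2) / (8 * N)) ≤
        Real.exp 1 * (Real.exp (A G / (4 * N)) + Real.exp (B G / (4 * N))) := by
    intro G
    have hmax : (∑ v, ((degIn G v S : ℝ) - (S.card : ℝ) / 2) ^ 2) / (8 * N) ≤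
        1 + max (A G / (4 * N)) (B G / (4 * N)) := by
      have h₁ := le_max_left (A G / (4 * N)) (B G / (4 * N))
      have h₂ := le_max_right (A G / (4 * N)) (B G / (4 * N))
      calc (∑ v, ((degIn G v S : ℝ) - (S.card : ℝ) / 2) ^ 2) / (8 * N)
          ≤ (A G + B G + N) / (8 * N) := by gcongr; exact hle G
        _ = (A G / (4 * N) + B G / (4 * N)) / 2 + 1 / 8 := by field_simp; ring
        _ ≤ _ := by linarith
    refine (Real.exp_le_exp.2 hmax).trans ?_
    rw [Real.exp_add]
    gcongr
    rcases max_choice (A G / (4 * N)) (B G / (4 * N)) with h | h <;> rw [h]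
    · exact le_add_of_nonneg_right (Real.exp_pos _).le
    · exact le_add_of_nonneg_left (Real.exp_pos _).le
  refine (Finset.sum_le_sum fun G _ => hexp G).trans ?_
  rw [← Finset.mul_sum, Finset.sum_add_distrib]
  have htwo : (2 : ℝ) ≤ Real.exp 1 := by linarith [Real.add_one_le_exp (1 : ℝ)]
  calc _ ≤ Real.exp 1 * (2 ^ N.choose 2 * Real.exp (N / 2) +
          2 ^ N.choose 2 * Real.exp (N / 2)) := by
        gcongr
    _ = 2 * (2 ^ N.choose 2 * Real.exp (N / 2) * Real.exp 1) := by ring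
    _ ≤ Real.exp 1 * (2 ^ N.choose 2 * Real.exp (N / 2) * Real.exp 1) := by gcongr
    _ = 2 ^ N.choose 2 * Real.exp (N / 2 + 2) := by
        rw [show (N : ℝ) / 2 + 2 = N / 2 + 1 + 1 by ring, Real.exp_add, Real.exp_add]
        ring

open Classical in
/-- Union bound and Markov's inequality for an exponential moment. -/
lemma card_exists_mul_exp_le {α β : Type*} [Fintype α] [Fintype β] (X : α → β → ℝ)
    (a M : ℝ) (hM : ∀ b, ∑ x, Real.exp (X x b) ≤ M) :
    (Nat.card {x : α // ∃ b, a ≤ X x b} : ℝ) * Real.exp a ≤ Fintype.card β * M := by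
  rw [Nat.card_eq_fintype_card, Fintype.card_subtype, ← nsmul_eq_mul]
  calc _ ≤ ∑ x ∈ Finset.univ.filter (fun x => ∃ b, a ≤ X x b), ∑ b, Real.exp (X x b) := by
        refine Finset.card_nsmul_le_sum _ _ _ fun x hx => ?_
        obtain ⟨b, hb⟩ := (Finset.mem_filter.1 hx).2
        exact (Real.exp_le_exp.2 hb).trans (Finset.single_le_sum
          (f := fun b => Real.exp (X x b)) (fun b _ => (Real.exp_pos _).le)
          (Finset.mem_univ b))
    _ ≤ ∑ x, ∑ b, Real.exp (X x b) :=
        Finset.sum_le_sum_of_subset_of_nonneg (Finset.filter_subset _ _) fun x _ _ =>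
          Finset.sum_nonneg fun b _ => (Real.exp_pos _).le
    _ = ∑ b, ∑ x, Real.exp (X x b) := Finset.sum_comm
    _ ≤ ∑ _b : β, M := Finset.sum_le_sum fun b _ => hM b
    _ = Fintype.card β * M := by simp

/-- For every `K > 0` there are `C > 0` and `n₀` such that for all
`n ≥ n₀`: for `G ∼ G(2n,1/2)`, the probability that some `S ⊆ [2n]` satisfies
`Σ_v (deg(v,S) − |S|/2)² ≥ C n²` is at most `exp(−Kn)`. -/
theorem degree_variance_large_deviation :
    ∀ K : ℝ, 0 < K → ∃ C : ℝ, 0 < C ∧ ∃ n₀ : ℕ, ∀ n : ℕ, n₀ ≤ n →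
      graphProb (2 * n) (fun G => ∃ S : Finset (Fin (2 * n)),
          C * (n : ℝ) ^ 2 ≤
            ∑ v : Fin (2 * n), ((degIn G v S : ℝ) - (S.card : ℝ) / 2) ^ 2)
        ≤ Real.exp (-K * n) := by
  intro K hK
  refine ⟨16 * (K + 5), by positivity, 1, fun n hn => ?_⟩
  have hn' : (1 : ℝ) ≤ n := by exact_mod_cast hn
  let X : SimpleGraph (Fin (2 * n)) → Finset (Fin (2 * n)) → ℝ := fun G S =>
    (∑ v, ((degIn G v S : ℝ) - (S.card : ℝ) / 2) ^ 2) / (8 * (2 * n : ℕ))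
  have hiff : ∀ G S, 16 * (K + 5) * (n : ℝ) ^ 2 ≤
      ∑ v : Fin (2 * n), ((degIn G v S : ℝ) - (S.card : ℝ) / 2) ^ 2 ↔
        (K + 5) * n ≤ X G S := by
    intro G S
    simp only [X]
    rw [le_div_iff₀ (by push_cast; positivity)]
    push_cast
    rw [show (K + 5) * n * (8 * (2 * n)) = 16 * (K + 5) * (n : ℝ) ^ 2 by ring]
  simp only [hiff]
  have hmarkov := card_exists_mul_exp_le X ((K + 5) * n) _
    (sum_graph_exp_degree_variance_le (by omega))
  rw [graphProb, div_le_iff₀ (by positivity)]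
  refine le_of_mul_le_mul_right (hmarkov.trans ?_) (Real.exp_pos ((K + 5) * n))
  have hcard : (Fintype.card (Finset (Fin (2 * n))) : ℝ) ≤ Real.exp (2 * n) := by
    have htwo : (2 : ℝ) ≤ Real.exp 1 := by linarith [Real.add_one_le_exp (1 : ℝ)]
    rw [Fintype.card_finset, Fintype.card_fin]
    calc ((2 ^ (2 * n) : ℕ) : ℝ) = 2 ^ (2 * n) := by push_cast; rfl
      _ ≤ Real.exp 1 ^ (2 * n) := by gcongr
      _ = Real.exp (2 * n) := by rw [← Real.exp_nat_mul]; push_cast; ring_nf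
  calc _ ≤ Real.exp (2 * n) *
        (2 ^ (2 * n).choose 2 * Real.exp (((2 * n : ℕ) : ℝ) / 2 + 2)) := by gcongr
    _ = 2 ^ (2 * n).choose 2 * Real.exp (2 * n + (((2 * n : ℕ) : ℝ) / 2 + 2)) := by
        rw [Real.exp_add (2 * (n : ℝ))]; ring
    _ ≤ 2 ^ (2 * n).choose 2 * Real.exp (-K * n + (K + 5) * n) := by
        refine mul_le_mul_of_nonneg_left (Real.exp_le_exp.2 ?_) (by positivity)
        push_cast
        linarith
    _ = _ := by rw [Real.exp_add]; ring
end

section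
/- For every c > 0 there exist C = C(c) > 0 and n_0 such that the following holds for all n ≥ n_0, all γ ∈ [−1,1], and every pair of partitions [2n] = A_1 ∪ A_2 = B_1 ∪ B_2 with |A_1| = |A_2| = |B_1| = |B_2| = n and c·n ≤ |A_1 ∩ B_1| ≤ (1−c)·n: for G ∼ G(2n,1/2), the probability of the event E_2 is at least exp(−C·n). -/
/-- The friendliness event for the partition `A ∪ Aᶜ` with margin `t`: every vertex has
at least `t` more neighbours in its own part than in the other part. -/
def FriendlyPair {m : ℕ} (G : SimpleGraph (Fin m)) (A : Finset (Fin m)) (t : ℝ) : Prop :=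
  (∀ v ∈ A, (degIn G v Aᶜ : ℝ) + t ≤ (degIn G v A : ℝ)) ∧
  (∀ v ∈ (Aᶜ : Finset (Fin m)), (degIn G v A : ℝ) + t ≤ (degIn G v Aᶜ : ℝ))

section

open Finset

/-- The signed sum over `P` of the `±1` configuration encoded by `s`. -/
noncomputable def signSum {E : Type*} [DecidableEq E] (P s : Finset E) : ℝ :=
  ∑ e ∈ P, if e ∈ s then 1 else -1

theorem sum_exp_signSum {E : Type*} [Fintype E] [DecidableEq E] (P : Finset E) (l : ℝ) :
    ∑ s : Finset E, Real.exp (l * signSum P s) =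
      2 ^ Fintype.card E * Real.cosh l ^ #P := by
  have h1 : ∏ e : E, ((if e ∈ P then Real.exp l else 1) +
      (if e ∈ P then Real.exp (-l) else 1)) = 2 ^ Fintype.card E * Real.cosh l ^ #P := by
    have : ∀ e : E, ((if e ∈ P then Real.exp l else 1) +
        (if e ∈ P then Real.exp (-l) else 1)) = 2 * (if e ∈ P then Real.cosh l else 1) := by
      intro e
      split_ifs
      · rw [Real.cosh_eq]; ring
      · norm_num
    simp only [this, Finset.prod_mul_distrib]
    simp [Finset.card_univ]
  rw [← h1, Fintype.prod_add]
  refine Finset.sum_congr rfl fun s _ => ?_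
  have h2 : Real.exp (l * signSum P s) =
      ∏ e : E, if e ∈ P then Real.exp (l * if e ∈ s then 1 else -1) else 1 := by
    rw [signSum, Finset.mul_sum, Real.exp_sum]
    simp
  rw [h2, ← Finset.prod_mul_prod_compl s]
  congr 1
  · refine Finset.prod_congr rfl fun e he => ?_
    simp [he]
  · refine Finset.prod_congr rfl fun e he => ?_
    have : e ∉ s := by simpa using he
    simp [this]

theorem sum_cosh_signSum {E : Type*} [Fintype E] [DecidableEq E] (P : Finset E) (l : ℝ) :
    ∑ s : Finset E, Real.cosh (l * signSum P s) =
      2 ^ Fintype.card E * Real.cosh l ^ #P := by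
  have h := sum_exp_signSum P l
  have h' := sum_exp_signSum P (-l)
  rw [Real.cosh_neg] at h'
  simp only [Real.cosh_eq (_ * _), ← Finset.sum_div, Finset.sum_add_distrib, ← neg_mul]
  rw [h, h']; ring

theorem quartic_le_cosh (x : ℝ) : 1 + x ^ 2 / 2 + x ^ 4 / 24 ≤ Real.cosh x := by
  have h := Real.hasSum_cosh x
  have := h.summable.sum_le_tsum (Finset.range 3) (fun i _ => by
    rw [pow_mul]; positivity)
  rw [h.tsum_eq] at this
  simpa [Finset.sum_range_succ, Nat.factorial] using this

theorem exp_le_cosh_of_abs_le_one {l : ℝ} (h0 : 0 ≤ l) (h1 : l ≤ 1) :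
    Real.exp (l ^ 2 / 4) ≤ Real.cosh l := by
  have hu : l ^ 2 ≤ 1 := by nlinarith
  have h := quartic_le_cosh l
  have h2 : 1 - l ^ 2 / 4 ≤ Real.exp (-(l ^ 2 / 4)) := by
    linarith [Real.add_one_le_exp (-(l ^ 2 / 4))]
  have h3 : Real.exp (l ^ 2 / 4) * Real.exp (-(l ^ 2 / 4)) = 1 := by
    rw [← Real.exp_add]; simp
  have h4 := Real.exp_pos (l ^ 2 / 4)
  have h5 : Real.exp (l ^ 2 / 4) * (1 - l ^ 2 / 4) ≤ 1 := by
    exact (mul_le_mul_of_nonneg_left h2 h4.le).trans h3.le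
  have h6 : Real.exp (l ^ 2 / 4) ≤ 1 + l ^ 2 / 2 := by
    by_contra! hc
    nlinarith [sq_nonneg l, sq_nonneg (l ^ 2)]
  nlinarith [sq_nonneg (l ^ 2)]

/-- Gaussian-type lower bound on the upper tail of a sum of independent signs. -/
theorem exp_le_card_signSum_ge {E : Type*} [Fintype E] [DecidableEq E] (P : Finset E) {t : ℝ}
    (ht : 0 < t) (hNt : (#P : ℝ) ≤ t ^ 2) (htN : 8 * t ≤ #P) :
    Real.exp (-(128 * t ^ 2 / #P)) * 2 ^ Fintype.card E ≤
      (#{s : Finset E | t ≤ signSum P s} : ℝ) := by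
  set N : ℝ := (#P : ℝ) with hN
  have hNpos : 0 < N := by linarith
  set M : ℝ := 2 ^ Fintype.card E with hM
  have hMpos : 0 < M := by positivity
  set l : ℝ := 8 * t / N with hl
  have hl0 : 0 ≤ l := by positivity
  have hl1 : l ≤ 1 := by rw [hl, div_le_one hNpos]; exact htN
  set F : Finset (Finset E) := {s : Finset E | t ≤ signSum P s} with hF
  set a : ℝ := ∑ s ∈ F, Real.exp (l * signSum P s) with ha
  have hsplit : a + ∑ s ∈ Fᶜ, Real.exp (l * signSum P s) = M * Real.cosh l ^ #P := by
    rw [← sum_exp_signSum, ha, Finset.sum_add_sum_compl]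
  have hcompl : ∑ s ∈ Fᶜ, Real.exp (l * signSum P s) ≤ M * Real.exp (l * t) := by
    calc ∑ s ∈ Fᶜ, Real.exp (l * signSum P s) ≤ ∑ s ∈ Fᶜ, Real.exp (l * t) := by
          refine Finset.sum_le_sum fun s hs => ?_
          have : signSum P s < t := by simpa [hF] using hs
          gcongr
      _ = #Fᶜ * Real.exp (l * t) := by simp
      _ ≤ M * Real.exp (l * t) := by
          gcongr
          have : #Fᶜ ≤ 2 ^ Fintype.card E := by
            rw [← Fintype.card_finset]; exact Finset.card_le_univ _
          rw [hM]; exact_mod_cast this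
  have hcosh : 2 * Real.exp (l * t) ≤ Real.cosh l ^ #P := by
    calc 2 * Real.exp (l * t) ≤ Real.exp (8 * (t ^ 2 / N)) * Real.exp (l * t) := by
          gcongr
          have h1 : 1 ≤ t ^ 2 / N := by rw [le_div_iff₀ hNpos]; linarith
          linarith [Real.add_one_le_exp (8 * (t ^ 2 / N))]
      _ = Real.exp (l ^ 2 / 4) ^ #P := by
          rw [← Real.exp_add, ← Real.exp_nat_mul, ← hN, hl]
          congr 1; field_simp; ring
      _ ≤ Real.cosh l ^ #P := by
          gcongr; exact exp_le_cosh_of_abs_le_one hl0 hl1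
  have haM : M ≤ a := by
    have h1 : 1 ≤ Real.exp (l * t) := Real.one_le_exp (by positivity)
    nlinarith
  have hCS : a ^ 2 ≤ #F * ∑ s ∈ F, Real.exp (l * signSum P s) ^ 2 := sq_sum_le_card_mul_sum_sq
  have hsq : ∑ s ∈ F, Real.exp (l * signSum P s) ^ 2 ≤ M * Real.exp (128 * t ^ 2 / N) := by
    calc ∑ s ∈ F, Real.exp (l * signSum P s) ^ 2
        ≤ ∑ s : Finset E, Real.exp (l * signSum P s) ^ 2 :=
          Finset.sum_le_univ_sum_of_nonneg fun s => by positivity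
      _ = ∑ s : Finset E, Real.exp ((2 * l) * signSum P s) := by
          refine Finset.sum_congr rfl fun s _ => ?_
          rw [← Real.exp_nat_mul]; congr 1; push_cast; ring
      _ = M * Real.cosh (2 * l) ^ #P := sum_exp_signSum P _
      _ ≤ M * Real.exp ((2 * l) ^ 2 / 2) ^ #P := by
          gcongr
          exact Real.cosh_le_exp_half_sq _
      _ = M * Real.exp (128 * t ^ 2 / N) := by
          rw [← Real.exp_nat_mul, ← hN, hl]
          congr 2; field_simp; ring
  have hfin : M ^ 2 ≤ #F * (M * Real.exp (128 * t ^ 2 / N)) :=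
    calc M ^ 2 ≤ a ^ 2 := by gcongr
      _ ≤ _ := hCS
      _ ≤ _ := by gcongr
  rw [Real.exp_neg, inv_mul_le_iff₀ (Real.exp_pos _)]
  nlinarith

/-- Harris–Kleitman inequality for finitely many increasing events. -/
theorem prod_card_le_card_forall {E ι : Type*} [Fintype E] [DecidableEq E] [DecidableEq ι]
    (V : Finset ι) (f : ι → Finset E → ℝ) (hf : ∀ v, Monotone (f v)) (t p : ι → ℝ)
    (hp0 : ∀ v, 0 ≤ p v)
    (hp : ∀ v, p v * 2 ^ Fintype.card E ≤ (#{s : Finset E | t v ≤ f v s} : ℝ)) :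
    (∏ v ∈ V, p v) * 2 ^ Fintype.card E ≤
      (#{s : Finset E | ∀ v ∈ V, t v ≤ f v s} : ℝ) := by
  induction V using Finset.induction_on with
  | empty => simp
  | insert v V hv ih =>
    have h1 : IsUpperSet (({s : Finset E | t v ≤ f v s} : Finset (Finset E)) :
        Set (Finset E)) := by
      intro a b hab ha
      simp only [coe_filter, mem_univ, true_and, Set.mem_ofPred_eq] at ha ⊢
      exact ha.trans (hf v hab)
    have h2 : IsUpperSet (({s : Finset E | ∀ w ∈ V, t w ≤ f w s} : Finset (Finset E)) :
        Set (Finset E)) := by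
      intro a b hab ha
      simp only [coe_filter, mem_univ, true_and, Set.mem_ofPred_eq] at ha ⊢
      exact fun w hw => (ha w hw).trans (hf w hab)
    have h := h1.le_card_inter_finset h2
    have heq : ({s : Finset E | t v ≤ f v s} : Finset (Finset E)) ∩
        ({s : Finset E | ∀ w ∈ V, t w ≤ f w s} : Finset (Finset E)) =
        ({s : Finset E | ∀ w ∈ insert v V, t w ≤ f w s} : Finset (Finset E)) := by
      ext s; simp
    rw [heq] at h
    have hR : (#{s : Finset E | t v ≤ f v s} : ℝ) * #{s : Finset E | ∀ w ∈ V, t w ≤ f w s} ≤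
        2 ^ Fintype.card E * #{s : Finset E | ∀ w ∈ insert v V, t w ≤ f w s} := by
      exact_mod_cast h
    have hm := mul_le_mul (hp v) ih
      (mul_nonneg (Finset.prod_nonneg fun w _ => hp0 w) (by positivity)) (by positivity)
    rw [Finset.prod_insert hv]
    have hM : (0 : ℝ) < 2 ^ Fintype.card E := by positivity
    refine le_of_mul_le_mul_left ?_ hM
    linarith

theorem signSum_mono {E : Type*} [DecidableEq E] (P : Finset E) : Monotone (signSum P) := by
  intro a b hab
  refine Finset.sum_le_sum fun e _ => ?_
  by_cases ha : e ∈ a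
  · simp [ha, hab ha]
  · simp only [ha, if_false]; split_ifs <;> norm_num

theorem signSum_congr {E : Type*} [DecidableEq E] {P s t : Finset E}
    (h : ∀ e ∈ P, e ∈ s ↔ e ∈ t) : signSum P s = signSum P t :=
  Finset.sum_congr rfl fun e he => by simp [h e he]

/-- Resampling the coordinates outside `I` does not change the number of configurations for
which the events, which separate into a part on `I` and a part off `I`, all hold. -/
theorem sum_card_le_card_good {E ι : Type*} [Fintype E] [DecidableEq E] [Fintype ι]
    (P Q : ι → Finset E) (I : Finset E) (hP : ∀ v, P v ⊆ I) (hQ : ∀ v, Disjoint (Q v) I)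
    (T : ℝ) :
    ∑ z : Finset E, #{s : Finset E | ∀ v, T + |signSum (Q v) z| ≤ signSum (P v) s} ≤
      #{s : Finset E | ∀ v, T + |signSum (Q v) s| ≤ signSum (P v) s} * 2 ^ Fintype.card E := by
  have h1 : ∑ z : Finset E, #{s : Finset E | ∀ v, T + |signSum (Q v) z| ≤ signSum (P v) s} =
      #{p : Finset E × Finset E | ∀ v, T + |signSum (Q v) p.2| ≤ signSum (P v) p.1} := by
    simp only [Finset.card_filter]
    rw [Fintype.sum_prod_type_right]
  have h2 : #{s : Finset E | ∀ v, T + |signSum (Q v) s| ≤ signSum (P v) s} *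
      2 ^ Fintype.card E =
      #(({s : Finset E | ∀ v, T + |signSum (Q v) s| ≤ signSum (P v) s} : Finset (Finset E)) ×ˢ
        (Finset.univ : Finset (Finset E))) := by
    rw [Finset.card_product, Finset.card_univ, Fintype.card_finset]
  rw [h1, h2]
  refine Finset.card_le_card_of_injOn
    (fun p => ((p.1 ∩ I) ∪ (p.2 \ I), (p.2 ∩ I) ∪ (p.1 \ I))) ?_ ?_
  · rintro ⟨s, z⟩ hsz
    simp only [coe_filter, mem_univ, true_and, Set.mem_ofPred_eq] at hsz
    simp only [coe_product, Set.mem_prod, coe_filter, mem_univ, true_and, Set.mem_ofPred_eq,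
      coe_univ, Set.mem_univ, and_true]
    intro v
    rw [signSum_congr (P := Q v) (t := z), signSum_congr (P := P v) (t := s)]
    · exact hsz v
    · intro e he
      simp [hP v he]
    · intro e he
      have : e ∉ I := Finset.disjoint_left.mp (hQ v) he
      simp [this]
  · rintro ⟨s, z⟩ - ⟨s', z'⟩ - h
    simp only [Prod.mk.injEq, Finset.ext_iff, mem_union, mem_inter, mem_sdiff] at h ⊢
    refine ⟨fun e => ?_, fun e => ?_⟩ <;>
    · have ha := h.1 e
      have hb := h.2 e
      by_cases he : e ∈ I <;> simp_all

/-- With probability at least one half, the exponential moments of the sums are bounded on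
average. -/
theorem two_pow_le_two_mul_card_cosh_le {E ι : Type*} [Fintype E] [DecidableEq E] [Fintype ι]
    {n : ℕ} (hn : 0 < n) (hι : Fintype.card ι = 2 * n) (Q : ι → Finset E)
    (hQ : ∀ v, #(Q v) ≤ 2 * n) :
    (2 : ℝ) ^ Fintype.card E ≤
      2 * #{z : Finset E | ∑ v, Real.cosh ((√n)⁻¹ * signSum (Q v) z) ≤ 12 * n} := by
  set M : ℝ := 2 ^ Fintype.card E with hM
  set Z : Finset (Finset E) := {z | ∑ v, Real.cosh ((√n)⁻¹ * signSum (Q v) z) ≤ 12 * n} with hZ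
  have hn' : (0 : ℝ) < n := by exact_mod_cast hn
  have hcosh : ∀ v, Real.cosh (√n)⁻¹ ^ #(Q v) ≤ 3 := by
    intro v
    calc Real.cosh (√n)⁻¹ ^ #(Q v) ≤ Real.cosh (√n)⁻¹ ^ (2 * n) :=
          pow_le_pow_right₀ (Real.one_le_cosh _) (hQ v)
      _ ≤ Real.exp ((√n)⁻¹ ^ 2 / 2) ^ (2 * n) := by
          gcongr
          exact Real.cosh_le_exp_half_sq _
      _ = Real.exp 1 := by
          rw [← Real.exp_nat_mul, inv_pow, Real.sq_sqrt hn'.le]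
          congr 1; push_cast; field_simp
      _ ≤ 3 := by linarith [Real.exp_one_lt_d9]
  have htot : ∑ z : Finset E, ∑ v, Real.cosh ((√n)⁻¹ * signSum (Q v) z) ≤ 6 * n * M := by
    rw [Finset.sum_comm]
    calc ∑ v, ∑ z : Finset E, Real.cosh ((√n)⁻¹ * signSum (Q v) z)
        ≤ ∑ v : ι, M * 3 := by
          refine Finset.sum_le_sum fun v _ => ?_
          rw [sum_cosh_signSum]
          exact mul_le_mul_of_nonneg_left (hcosh v) (by positivity)
      _ = 6 * n * M := by
          rw [Finset.sum_const, Finset.card_univ, hι, nsmul_eq_mul]; push_cast; ring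
  have hcompl : (12 * n : ℝ) * #Zᶜ ≤ 6 * n * M := by
    calc (12 * n : ℝ) * #Zᶜ = ∑ z ∈ Zᶜ, (12 * n : ℝ) := by
          rw [Finset.sum_const, nsmul_eq_mul, mul_comm]
      _ ≤ ∑ z ∈ Zᶜ, ∑ v, Real.cosh ((√n)⁻¹ * signSum (Q v) z) := by
          refine Finset.sum_le_sum fun z hz => ?_
          have : ¬ ∑ v, Real.cosh ((√n)⁻¹ * signSum (Q v) z) ≤ 12 * n := by
            simpa [hZ] using hz
          exact (not_le.mp this).le
      _ ≤ ∑ z : Finset E, ∑ v, Real.cosh ((√n)⁻¹ * signSum (Q v) z) :=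
          Finset.sum_le_univ_sum_of_nonneg fun z =>
            Finset.sum_nonneg fun v _ => (Real.cosh_pos _).le
      _ ≤ 6 * n * M := htot
  have hadd : (#Z : ℝ) + #Zᶜ = M := by
    rw [hM, ← Nat.cast_add, Finset.card_add_card_compl, Fintype.card_finset]; push_cast; rfl
  have : (2 : ℝ) * #Zᶜ ≤ M := by
    refine le_of_mul_le_mul_left ?_ (by positivity : (0 : ℝ) < 6 * n)
    linarith
  linarith

/-- Sums of independent signs over sets `P v` of linear size simultaneously dominate the
absolute values of independent sums with probability exponentially small in `n`. -/
theorem exp_le_card_abs_signSum_le_signSum {E ι : Type*} [Fintype E] [DecidableEq E]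
    [Fintype ι] [DecidableEq ι] {n : ℕ} (hn : 0 < n) {c : ℝ} (hc : 0 < c)
    (hι : Fintype.card ι = 2 * n) (P Q : ι → Finset E) (I : Finset E) (hP : ∀ v, P v ⊆ I)
    (hQ : ∀ v, Disjoint (Q v) I) (hPc : ∀ v, c * n ≤ #(P v)) (hPn : ∀ v, #(P v) ≤ 2 * n)
    (hQn : ∀ v, #(Q v) ≤ 2 * n)
    (hbig : ∀ r : ℝ, 0 ≤ r → r ^ 4 ≤ 288 * n ^ 3 → 8 * (3 * √n + r) ≤ c * n) :
    Real.exp (-(1 + 10752 / c) * n) * 2 ^ Fintype.card E ≤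
      (#{s : Finset E | ∀ v, 3 * √n + |signSum (Q v) s| ≤ signSum (P v) s} : ℝ) := by
  have hn' : (0 : ℝ) < n := by exact_mod_cast hn
  have hn1 : (1 : ℝ) ≤ n := by exact_mod_cast hn
  have hsq : √(n : ℝ) ^ 2 = n := Real.sq_sqrt hn'.le
  have hsqpos : 0 < √(n : ℝ) := Real.sqrt_pos.mpr hn'
  set M : ℝ := 2 ^ Fintype.card E with hM
  have hMpos : 0 < M := by positivity
  set Z : Finset (Finset E) := {z | ∑ v, Real.cosh ((√n)⁻¹ * signSum (Q v) z) ≤ 12 * n} with hZ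
  have hZM : M ≤ 2 * #Z := two_pow_le_two_mul_card_cosh_le hn hι Q hQn
  have key : ∀ z ∈ Z, Real.exp (-(10752 / c) * n) * M ≤
      (#{s : Finset E | ∀ v, 3 * √n + |signSum (Q v) z| ≤ signSum (P v) s} : ℝ) := by
    intro z hz
    have hz' : ∑ v, Real.cosh ((√n)⁻¹ * signSum (Q v) z) ≤ 12 * n := by simpa [hZ] using hz
    have hR4 : ∀ v, |signSum (Q v) z| ^ 4 ≤ 288 * (n : ℝ) ^ 3 := by
      intro v
      have h1 := Finset.single_le_sum
        (f := fun v => Real.cosh ((√n)⁻¹ * signSum (Q v) z))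
        (fun v _ => (Real.cosh_pos _).le) (Finset.mem_univ v)
      have h2 := quartic_le_cosh ((√n)⁻¹ * signSum (Q v) z)
      have h3 : ((√n)⁻¹ * signSum (Q v) z) ^ 4 = |signSum (Q v) z| ^ 4 / n ^ 2 := by
        rw [mul_pow, inv_pow, Even.pow_abs (by decide), ← hsq]
        field_simp
        rw [hsq]
      rw [h3] at h2
      have h4 : |signSum (Q v) z| ^ 4 / (n : ℝ) ^ 2 ≤ 288 * n := by
        nlinarith [sq_nonneg ((√n)⁻¹ * signSum (Q v) z)]
      rw [div_le_iff₀ (by positivity)] at h4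
      linarith
    have hR2 : ∑ v, signSum (Q v) z ^ 2 ≤ 24 * (n : ℝ) ^ 2 := by
      have h1 : ∑ v, signSum (Q v) z ^ 2 / (2 * n : ℝ) ≤ 12 * n := by
        refine (Finset.sum_le_sum fun v _ => ?_).trans hz'
        have h2 := quartic_le_cosh ((√n)⁻¹ * signSum (Q v) z)
        have h3 : ((√n)⁻¹ * signSum (Q v) z) ^ 2 = signSum (Q v) z ^ 2 / n := by
          rw [mul_pow, inv_pow, hsq]; field_simp
        have h4 : signSum (Q v) z ^ 2 / (2 * n : ℝ) = signSum (Q v) z ^ 2 / n / 2 := by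
          field_simp
        rw [h4, ← h3]
        nlinarith [sq_nonneg (((√n)⁻¹ * signSum (Q v) z) ^ 2)]
      rw [← Finset.sum_div, div_le_iff₀ (by positivity)] at h1
      linarith
    have hfkg := prod_card_le_card_forall Finset.univ (fun v => signSum (P v))
      (fun v => signSum_mono (P v)) (fun v => 3 * √n + |signSum (Q v) z|)
      (fun v => Real.exp (-(128 * (3 * √n + |signSum (Q v) z|) ^ 2 / #(P v))))
      (fun v => (Real.exp_pos _).le) (fun v => by
        refine exp_le_card_signSum_ge (P v) (by positivity) ?_ ?_
        · have h1 : (#(P v) : ℝ) ≤ 2 * n := by exact_mod_cast hPn v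
          nlinarith [abs_nonneg (signSum (Q v) z)]
        · exact (hbig _ (abs_nonneg _) (hR4 v)).trans (hPc v))
    simp only [Finset.mem_univ, forall_true_left] at hfkg
    refine le_trans ?_ hfkg
    rw [← Real.exp_sum]
    refine mul_le_mul_of_nonneg_right (Real.exp_le_exp.mpr ?_) hMpos.le
    rw [Finset.sum_neg_distrib, neg_mul, neg_le_neg_iff]
    calc ∑ v, 128 * (3 * √n + |signSum (Q v) z|) ^ 2 / (#(P v) : ℝ)
        ≤ ∑ v, 128 * (18 * n + 2 * signSum (Q v) z ^ 2) / (c * n) := by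
          refine Finset.sum_le_sum fun v _ => ?_
          have h1 : (3 * √n + |signSum (Q v) z|) ^ 2 ≤ 18 * n + 2 * signSum (Q v) z ^ 2 := by
            nlinarith [sq_nonneg (3 * √n - |signSum (Q v) z|), sq_abs (signSum (Q v) z)]
          exact div_le_div₀ (by positivity) (by linarith) (by positivity) (hPc v)
      _ = 128 * (36 * n ^ 2 + 2 * ∑ v, signSum (Q v) z ^ 2) / (c * n) := by
          rw [← Finset.sum_div, ← Finset.mul_sum, Finset.sum_add_distrib, Finset.sum_const,
            Finset.card_univ, hι, ← Finset.mul_sum, nsmul_eq_mul]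
          push_cast; ring
      _ ≤ 128 * (36 * n ^ 2 + 2 * (24 * n ^ 2)) / (c * n) := by gcongr
      _ = 10752 / c * n := by field_simp; ring
  have hsum : (#Z : ℝ) * (Real.exp (-(10752 / c) * n) * M) ≤
      (#{s : Finset E | ∀ v, 3 * √n + |signSum (Q v) s| ≤ signSum (P v) s} : ℝ) * M := by
    calc (#Z : ℝ) * (Real.exp (-(10752 / c) * n) * M)
        = ∑ z ∈ Z, Real.exp (-(10752 / c) * n) * M := by
          rw [Finset.sum_const, nsmul_eq_mul]
      _ ≤ ∑ z ∈ Z, (#{s : Finset E | ∀ v, 3 * √n + |signSum (Q v) z| ≤ signSum (P v) s} : ℝ) :=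
          Finset.sum_le_sum key
      _ ≤ ∑ z, (#{s : Finset E | ∀ v, 3 * √n + |signSum (Q v) z| ≤ signSum (P v) s} : ℝ) :=
          Finset.sum_le_univ_sum_of_nonneg fun z => by positivity
      _ ≤ _ := by
          rw [hM]
          exact_mod_cast sum_card_le_card_good P Q I hP hQ (3 * √n)
  have hhalf : 2 * Real.exp (-(n : ℝ)) ≤ 1 := by
    rw [Real.exp_neg, ← div_eq_mul_inv, div_le_one (Real.exp_pos _)]
    linarith [Real.add_one_le_exp (n : ℝ)]
  have hexp : Real.exp (-(1 + 10752 / c) * n) =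
      Real.exp (-(n : ℝ)) * Real.exp (-(10752 / c) * n) := by
    rw [← Real.exp_add]; congr 1; ring
  rw [hexp]
  refine le_of_mul_le_mul_right (le_trans ?_ hsum) hMpos
  have hx : Real.exp (-(n : ℝ)) * M ≤ #Z := by nlinarith [Real.exp_pos (-(n : ℝ))]
  have hy : 0 ≤ Real.exp (-(10752 / c) * n) * M := by positivity
  nlinarith

/-- The indicator of the part of the bipartition `S ∪ Sᶜ` containing `v`, as a sign. -/
noncomputable def sideSign {m : ℕ} (S : Finset (Fin m)) (v : Fin m) : ℝ :=
  if v ∈ S then 1 else -1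

theorem sideSign_mul_self {m : ℕ} (S : Finset (Fin m)) (v : Fin m) :
    sideSign S v * sideSign S v = 1 := by
  unfold sideSign; split_ifs <;> norm_num

theorem sum_sideSign {n : ℕ} {S : Finset (Fin (2 * n))} (hS : #S = n) :
    ∑ w, sideSign S w = 0 := by
  have hc : #Sᶜ = n := by rw [Finset.card_compl, Fintype.card_fin, hS]; omega
  rw [← Finset.sum_add_sum_compl S, Finset.sum_congr rfl (g := fun _ => (1 : ℝ)),
    Finset.sum_congr (s₁ := Sᶜ) rfl (g := fun _ => (-1 : ℝ))]
  · simp [hS, hc]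
  · intro w hw; simp [sideSign, Finset.mem_compl.mp hw]
  · intro w hw; simp [sideSign, hw]

open Classical in
theorem degIn_eq_sum {m : ℕ} (G : SimpleGraph (Fin m)) (v : Fin m) (S : Finset (Fin m)) :
    (degIn G v S : ℝ) = ∑ w, if w ∈ S ∧ G.Adj v w then 1 else 0 := by
  rw [degIn, Nat.card_eq_fintype_card, Fintype.card_subtype, Finset.card_filter]
  push_cast; rfl

open Classical in
theorem sideSign_mul_degIn_sub {n : ℕ} (G : SimpleGraph (Fin (2 * n)))
    {S : Finset (Fin (2 * n))} (hS : #S = n) (v : Fin (2 * n)) :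
    2 * (sideSign S v * ((degIn G v S : ℝ) - degIn G v Sᶜ)) =
      ∑ w ∈ Finset.univ.erase v,
        sideSign S v * sideSign S w * (if G.Adj v w then 1 else -1) - 1 := by
  have h1 : (degIn G v S : ℝ) - degIn G v Sᶜ =
      ∑ w ∈ Finset.univ.erase v, sideSign S w * (if G.Adj v w then 1 else 0) := by
    rw [degIn_eq_sum, degIn_eq_sum, ← Finset.sum_sub_distrib,
      ← Finset.add_sum_erase _ _ (Finset.mem_univ v)]
    simp only [SimpleGraph.irrefl, and_false, if_false, sub_zero, zero_add]
    refine Finset.sum_congr rfl fun w _ => ?_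
    by_cases hw : w ∈ S <;> by_cases ha : G.Adj v w <;> simp [sideSign, hw, ha]
  have h2 : ∑ w ∈ Finset.univ.erase v, sideSign S v * sideSign S w = -1 := by
    have h := sum_sideSign hS
    rw [← Finset.add_sum_erase _ _ (Finset.mem_univ v)] at h
    rw [← Finset.mul_sum, eq_neg_of_add_eq_zero_right h, mul_neg, sideSign_mul_self]
  have h3 : 2 * (sideSign S v * ((degIn G v S : ℝ) - degIn G v Sᶜ)) =
      ∑ w ∈ Finset.univ.erase v,
        sideSign S v * sideSign S w * (if G.Adj v w then 1 else -1) +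
      ∑ w ∈ Finset.univ.erase v, sideSign S v * sideSign S w := by
    rw [h1, ← Finset.sum_add_distrib, Finset.mul_sum, Finset.mul_sum]
    refine Finset.sum_congr rfl fun w _ => ?_
    split_ifs <;> ring
  rw [h3, h2, sub_eq_add_neg]

open Classical in
theorem friendlyPair_of_le_sum {n : ℕ} {G : SimpleGraph (Fin (2 * n))}
    {S : Finset (Fin (2 * n))} (hS : #S = n) {t : ℝ}
    (h : ∀ v, 2 * t + 1 ≤ ∑ w ∈ Finset.univ.erase v,
      sideSign S v * sideSign S w * (if G.Adj v w then 1 else -1)) :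
    FriendlyPair G S t := by
  constructor
  · intro v hv
    have h1 := sideSign_mul_degIn_sub G hS v
    rw [show sideSign S v = 1 by simp [sideSign, hv]] at h1
    have h2 := h v
    rw [show sideSign S v = 1 by simp [sideSign, hv]] at h2
    linarith
  · intro v hv
    have hv' := Finset.mem_compl.mp hv
    have h1 := sideSign_mul_degIn_sub G hS v
    rw [show sideSign S v = -1 by simp [sideSign, hv']] at h1
    have h2 := h v
    rw [show sideSign S v = -1 by simp [sideSign, hv']] at h2
    linarith

/-- The pairs at `v` on which the bipartitions given by `A` and `B` agree. -/
noncomputable def agreeingPairs {m : ℕ} (A B : Finset (Fin m)) (v : Fin m) :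
    Finset (Sym2 (Fin m)) :=
  {w ∈ Finset.univ.erase v | (w ∈ A ↔ w ∈ B) ↔ (v ∈ A ↔ v ∈ B)}.image (fun w => s(v, w))

/-- The pairs at `v` which exactly one of the bipartitions given by `A` and `B` separates. -/
noncomputable def disagreeingPairs {m : ℕ} (A B : Finset (Fin m)) (v : Fin m) :
    Finset (Sym2 (Fin m)) :=
  {w ∈ Finset.univ.erase v | ¬((w ∈ A ↔ w ∈ B) ↔ (v ∈ A ↔ v ∈ B))}.image (fun w => s(v, w))

/-- The graph encoded by `s`, in which membership in `s` means that the pair is friendly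
with respect to `A`: an edge inside a part or a non-edge across. -/
def twistedGraph {m : ℕ} (A : Finset (Fin m)) (s : Finset (Sym2 (Fin m))) :
    SimpleGraph (Fin m) where
  Adj v w := v ≠ w ∧ (s(v, w) ∈ s ↔ (v ∈ A ↔ w ∈ A))
  symm := ⟨fun v w h => ⟨h.1.symm, by rw [Sym2.eq_swap, h.2]; exact iff_comm⟩⟩
  loopless := ⟨fun v h => h.1 rfl⟩

theorem signSum_image_mk {m : ℕ} (v : Fin m) (W : Finset (Fin m))
    (s : Finset (Sym2 (Fin m))) :
    signSum (W.image (fun w => s(v, w))) s = ∑ w ∈ W, if s(v, w) ∈ s then 1 else -1 := by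
  rw [signSum, Finset.sum_image]
  intro a _ b _ hab
  exact Sym2.congr_right.mp hab

open Classical in
theorem sum_sideSign_twistedGraph_left {m : ℕ} (A B : Finset (Fin m))
    (s : Finset (Sym2 (Fin m))) (v : Fin m) :
    ∑ w ∈ Finset.univ.erase v,
        sideSign A v * sideSign A w * (if (twistedGraph A s).Adj v w then 1 else -1) =
      signSum (agreeingPairs A B v) s + signSum (disagreeingPairs A B v) s := by
  rw [agreeingPairs, disagreeingPairs, signSum_image_mk, signSum_image_mk,
    Finset.sum_filter_add_sum_filter_not]
  refine Finset.sum_congr rfl fun w hw => ?_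
  have hvw : v ≠ w := (Finset.ne_of_mem_erase hw).symm
  by_cases h1 : v ∈ A <;> by_cases h2 : w ∈ A <;> by_cases h3 : s(v, w) ∈ s <;>
    simp [sideSign, twistedGraph, h1, h2, h3, hvw]

open Classical in
theorem sum_sideSign_twistedGraph_right {m : ℕ} (A B : Finset (Fin m))
    (s : Finset (Sym2 (Fin m))) (v : Fin m) :
    ∑ w ∈ Finset.univ.erase v,
        sideSign B v * sideSign B w * (if (twistedGraph A s).Adj v w then 1 else -1) =
      signSum (agreeingPairs A B v) s - signSum (disagreeingPairs A B v) s := by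
  rw [agreeingPairs, disagreeingPairs, signSum_image_mk, signSum_image_mk,
    ← Finset.sum_filter_add_sum_filter_not _
      (fun w => (w ∈ A ↔ w ∈ B) ↔ (v ∈ A ↔ v ∈ B)), sub_eq_add_neg, ← Finset.sum_neg_distrib]
  congr 1
  all_goals
    refine Finset.sum_congr rfl fun w hw => ?_
    rw [Finset.mem_filter] at hw
    have hvw : v ≠ w := (Finset.ne_of_mem_erase hw.1).symm
    have hw2 := hw.2
    by_cases h1 : v ∈ A <;> by_cases h2 : w ∈ A <;> by_cases h3 : s(v, w) ∈ s <;>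
      by_cases h4 : v ∈ B <;> by_cases h5 : w ∈ B <;>
      simp_all [sideSign, twistedGraph]

theorem card_image_mk {m : ℕ} (v : Fin m) (W : Finset (Fin m)) :
    #(W.image (fun w => s(v, w))) = #W :=
  Finset.card_image_of_injective _ fun _ _ hab => Sym2.congr_right.mp hab

theorem card_filter_iff {n : ℕ} {A B : Finset (Fin (2 * n))} (hA : #A = n) (hB : #B = n) :
    #{w | w ∈ A ↔ w ∈ B} = 2 * #(A ∩ B) := by
  have h1 : ({w | w ∈ A ↔ w ∈ B} : Finset (Fin (2 * n))) = (A ∩ B) ∪ (A ∪ B)ᶜ := by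
    ext w; simp only [mem_filter, mem_univ, true_and, mem_union, mem_inter, mem_compl]; tauto
  have h2 : Disjoint (A ∩ B) (A ∪ B)ᶜ := by
    rw [Finset.disjoint_left]; intro w; simp only [mem_inter, mem_compl, mem_union]; tauto
  rw [h1, Finset.card_union_of_disjoint h2, Finset.card_compl, Fintype.card_fin]
  have := Finset.card_union_add_card_inter A B
  omega

theorem le_card_agreeingPairs {n : ℕ} {A B : Finset (Fin (2 * n))} (hA : #A = n)
    (hB : #B = n) {c : ℝ} (hcn : 1 ≤ c * n) (h1 : c * n ≤ #(A ∩ B))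
    (h2 : (#(A ∩ B) : ℝ) ≤ (1 - c) * n) (v : Fin (2 * n)) :
    c * n ≤ #(agreeingPairs A B v) := by
  have hk := card_filter_iff hA hB
  have hk' : #{w | w ∈ A ↔ w ∈ B} + #{w | ¬(w ∈ A ↔ w ∈ B)} = 2 * n := by
    rw [Finset.card_filter_add_card_filter_not, Finset.card_univ, Fintype.card_fin]
  have h3 : #(agreeingPairs A B v) + 1 = #{w | (w ∈ A ↔ w ∈ B) ↔ (v ∈ A ↔ v ∈ B)} := by
    rw [agreeingPairs, card_image_mk, Finset.filter_erase, Finset.card_erase_add_one]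
    simp
  have hk2 : (#{w | w ∈ A ↔ w ∈ B} : ℝ) = 2 * #(A ∩ B) := by exact_mod_cast hk
  have hk2' : (#{w | w ∈ A ↔ w ∈ B} : ℝ) + #{w | ¬(w ∈ A ↔ w ∈ B)} = 2 * n := by
    exact_mod_cast hk'
  have h3' : (#(agreeingPairs A B v) : ℝ) + 1 =
      #{w | (w ∈ A ↔ w ∈ B) ↔ (v ∈ A ↔ v ∈ B)} := by exact_mod_cast h3
  by_cases hv : v ∈ A ↔ v ∈ B
  · simp only [hv, iff_true] at h3'
    linarith
  · simp only [hv, iff_false] at h3'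
    linarith

theorem card_filter_twistedGraph_le {m : ℕ} (A : Finset (Fin m))
    (p : SimpleGraph (Fin m) → Prop) (F : Finset (Finset (Sym2 (Fin m))))
    (hF : ∀ s ∈ F, p (twistedGraph A s)) :
    #F ≤ Nat.card {G : SimpleGraph (Fin m) // p G} * 2 ^ m := by
  classical
  have hcard : Nat.card ({G : SimpleGraph (Fin m) // p G} × Finset (Fin m)) =
      Nat.card {G : SimpleGraph (Fin m) // p G} * 2 ^ m := by
    rw [Nat.card_prod, Nat.card_eq_fintype_card (α := Finset (Fin m)), Fintype.card_finset,
      Fintype.card_fin]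
  have hFcard : #F = Nat.card (F : Set (Finset (Sym2 (Fin m)))) := by simp
  rw [← hcard, hFcard]
  refine Nat.card_le_card_of_injective (fun s : (F : Set (Finset (Sym2 (Fin m)))) =>
    ((⟨twistedGraph A s.1, hF s.1 s.2⟩ : {G : SimpleGraph (Fin m) // p G}),
      ({v | s(v, v) ∈ s.1} : Finset (Fin m)))) ?_
  rintro ⟨s, hs⟩ ⟨s', hs'⟩ h
  simp only [Prod.mk.injEq, Subtype.mk.injEq] at h
  obtain ⟨hG, hd⟩ := h
  ext e
  induction e using Sym2.ind with
  | _ v w =>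
    by_cases hvw : v = w
    · subst hvw
      simpa using Finset.ext_iff.mp hd v
    · have := congrFun (congrFun (congrArg SimpleGraph.Adj hG) v) w
      simp only [twistedGraph, eq_iff_iff] at this
      simp only
      tauto

theorem deviation_le_of_large {c : ℝ} (hc : 0 < c) {n : ℕ} (h1 : 2304 / c ^ 2 ≤ n)
    (h2 : 288 * (16 / c) ^ 4 ≤ n) (r : ℝ) (_ : 0 ≤ r) (hr4 : r ^ 4 ≤ 288 * n ^ 3) :
    8 * (3 * √n + r) ≤ c * n := by
  have hn : (0 : ℝ) ≤ n := Nat.cast_nonneg n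
  have hs : √(n : ℝ) ≤ c * n / 48 := by
    rw [Real.sqrt_le_left (by positivity)]
    rw [div_le_iff₀ (by positivity)] at h1
    nlinarith
  have hr' : r ≤ c * n / 16 := by
    refine le_of_pow_le_pow_left₀ (n := 4) (by norm_num) (by positivity) (hr4.trans ?_)
    have h3 : 288 * (n : ℝ) ^ 3 = 288 * (16 / c) ^ 4 * (n ^ 3 * (c / 16) ^ 4) := by
      field_simp
    rw [h3]
    calc 288 * (16 / c) ^ 4 * (n ^ 3 * (c / 16) ^ 4) ≤ n * (n ^ 3 * (c / 16) ^ 4) := by gcongr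
      _ = (c * n / 16) ^ 4 := by ring
  linarith

end

/-- For every `c > 0` there are `C > 0` and `n₀` such that for all
`n ≥ n₀`, `γ ∈ [−1,1]`, and every pair of bisections `A ∪ Aᶜ`, `B ∪ Bᶜ` of `[2n]` with
`cn ≤ |A ∩ B| ≤ (1−c)n`: for `G ∼ G(2n,1/2)`, `P[E₂] ≥ exp(−Cn)`. -/
theorem friendly_pair_probability_lower_bound :
    ∀ c : ℝ, 0 < c → ∃ C : ℝ, 0 < C ∧ ∃ n₀ : ℕ, ∀ n : ℕ, n₀ ≤ n →
      ∀ γ : ℝ, |γ| ≤ 1 →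
      ∀ A B : Finset (Fin (2 * n)), A.card = n → B.card = n →
        c * n ≤ ((A ∩ B).card : ℝ) → ((A ∩ B).card : ℝ) ≤ (1 - c) * n →
        Real.exp (-C * n) ≤
          graphProb (2 * n) (fun G =>
            FriendlyPair G A (γ * Real.sqrt n) ∧ FriendlyPair G B (γ * Real.sqrt n)) := by
  intro c hc
  refine ⟨1 + 10752 / c, by positivity,
    ⌈1 + 1 / c + 2304 / c ^ 2 + 288 * (16 / c) ^ 4⌉₊, ?_⟩
  intro n hn₀ γ hγ A B hA hB h1 h2
  have hn₁ := Nat.ceil_le.mp hn₀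
  have hp1 : 0 < 1 / c := by positivity
  have hp2 : 0 < 2304 / c ^ 2 := by positivity
  have hp3 : 0 < 288 * (16 / c) ^ 4 := by positivity
  have hn1 : (1 : ℝ) ≤ n := by linarith
  have hn : 0 < n := by
    have : (0 : ℝ) < n := by linarith
    exact_mod_cast this
  have hcn : 1 ≤ c * n := by
    have : 1 / c ≤ n := by linarith
    rwa [div_le_iff₀ hc, mul_comm] at this
  have hcardle : ∀ (v : Fin (2 * n)) (W : Finset (Fin (2 * n))),
      (W.image (fun w => s(v, w))).card ≤ 2 * n := fun v W => by
    rw [card_image_mk]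
    exact (Finset.card_le_univ W).trans_eq (Fintype.card_fin _)
  classical
  have hcount := exp_le_card_abs_signSum_le_signSum hn hc (Fintype.card_fin (2 * n))
    (agreeingPairs A B) (disagreeingPairs A B)
    {e | ∀ a ∈ e, ∀ b ∈ e, (a ∈ A ↔ a ∈ B) ↔ (b ∈ A ↔ b ∈ B)}
    (fun v e he => by
      obtain ⟨w, hw, rfl⟩ := Finset.mem_image.mp he
      have hw2 := (Finset.mem_filter.mp hw).2
      simp only [Finset.mem_filter, Finset.mem_univ, true_and, Sym2.mem_iff]
      rintro a (rfl | rfl) b (rfl | rfl) <;> tauto)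
    (fun v => by
      rw [Finset.disjoint_left]
      intro e he
      obtain ⟨w, hw, rfl⟩ := Finset.mem_image.mp he
      have hw2 := (Finset.mem_filter.mp hw).2
      simp only [Finset.mem_filter, Finset.mem_univ, true_and]
      intro h
      exact hw2 (h w (by simp) v (by simp)))
    (le_card_agreeingPairs hA hB hcn h1 h2) (fun v => hcardle v _) (fun v => hcardle v _)
    (deviation_le_of_large hc (by linarith) (by linarith))
  have hsqrt : 1 ≤ √(n : ℝ) := Real.one_le_sqrt.mpr hn1
  have hγn : 2 * (γ * √n) + 1 ≤ 3 * √n := by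
    have := (abs_le.mp hγ).2
    nlinarith
  have hgraph := card_filter_twistedGraph_le A
    (fun G => FriendlyPair G A (γ * √n) ∧ FriendlyPair G B (γ * √n))
    {s | ∀ v, 3 * √n + |signSum (disagreeingPairs A B v) s| ≤ signSum (agreeingPairs A B v) s}
    (fun s hs => by
      simp only [Finset.mem_filter, Finset.mem_univ, true_and] at hs
      constructor
      · refine friendlyPair_of_le_sum hA fun v => ?_
        rw [sum_sideSign_twistedGraph_left A B]
        linarith [hs v, neg_abs_le (signSum (disagreeingPairs A B v) s)]
      · refine friendlyPair_of_le_sum hB fun v => ?_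
        rw [sum_sideSign_twistedGraph_right A B]
        linarith [hs v, le_abs_self (signSum (disagreeingPairs A B v) s)])
  rw [graphProb, le_div_iff₀ (by positivity)]
  have hE : Fintype.card (Sym2 (Fin (2 * n))) = (2 * n).choose 2 + 2 * n := by
    rw [Sym2.card, Fintype.card_fin, Nat.choose_succ_succ' (2 * n) 1, Nat.choose_one_right,
      add_comm]
  rw [hE, pow_add, ← mul_assoc] at hcount
  refine le_of_mul_le_mul_right (hcount.trans ?_) (by positivity : (0 : ℝ) < 2 ^ (2 * n))
  exact_mod_cast hgraph
end

section
/- There exists an absolute constant C > 0 such that for all integers n ≥ 1 and 0 ≤ ℓ ≤ n: C(n,ℓ) / Σ_{k=ℓ}^{n} C(n,k) ≤ C · ( |ℓ − n/2|/n + 1/√n ). -/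
theorem succ_mul_choose_succ_cast {n l : ℕ} (h : l ≤ n) :
    ((l : ℝ) + 1) * (n.choose (l + 1) : ℝ) = ((n : ℝ) - l) * (n.choose l : ℝ) := by
  have h1 : ((n.choose (l + 1) * (l + 1) : ℕ) : ℝ) = ((n.choose l * (n - l) : ℕ) : ℝ) :=
    congrArg _ (Nat.choose_succ_right_eq n l)
  push_cast [Nat.cast_sub h] at h1
  linarith

/-- The first centred moment of the binomial weights over the tail `k ≥ l` telescopes. -/
theorem sum_Icc_mul_choose {n l : ℕ} (h : l ≤ n) :
    ∑ k ∈ Finset.Icc l n, (2 * (k : ℝ) - n) * (n.choose k : ℝ) = l * (n.choose l : ℝ) := by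
  induction h using Nat.decreasingInduction with
  | self => simp; ring
  | of_succ l h ih =>
    rw [← Finset.add_sum_Ioc_eq_sum_Icc h.le, ← Finset.Icc_add_one_left_eq_Ioc, ih]
    have := succ_mul_choose_succ_cast h.le
    push_cast
    linarith

/-- The second centred moment of the binomial weights over the tail `k ≥ l`, up to an error of
`2 * n` times the tail. -/
theorem sum_Icc_sq_mul_choose_le {n l : ℕ} (h : l ≤ n) :
    ∑ k ∈ Finset.Icc l n, (2 * (k : ℝ) - n) ^ 2 * (n.choose k : ℝ) ≤
      (2 * (l : ℝ) - n) * (l * (n.choose l : ℝ)) +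
        2 * n * ∑ k ∈ Finset.Icc l n, (n.choose k : ℝ) := by
  induction h using Nat.decreasingInduction with
  | self =>
    have : (0 : ℝ) ≤ n := n.cast_nonneg
    simp
    nlinarith
  | of_succ l h ih =>
    simp only [← Finset.add_sum_Ioc_eq_sum_Icc h.le, ← Finset.Icc_add_one_left_eq_Ioc]
    have hrec := succ_mul_choose_succ_cast h.le
    push_cast at ih
    rw [hrec] at ih
    have : (0 : ℝ) ≤ l * (n.choose l : ℝ) := by positivity
    linarith

/-- There is an absolute constant `C > 0` such that for all `n ≥ 1` and
`0 ≤ ℓ ≤ n`: `C(n,ℓ) / Σ_{k=ℓ}^n C(n,k) ≤ C · (|ℓ − n/2|/n + 1/√n)`. -/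
theorem binomial_tail_ratio :
    ∃ C : ℝ, 0 < C ∧
      ∀ n : ℕ, 1 ≤ n → ∀ ℓ : ℕ, ℓ ≤ n →
        (n.choose ℓ : ℝ) / (∑ k ∈ Finset.Icc ℓ n, (n.choose k : ℝ))
          ≤ C * (|(ℓ : ℝ) - (n : ℝ) / 2| / n + 1 / Real.sqrt n) := by
  refine ⟨8, by norm_num, fun n hn l hl => ?_⟩
  have hn0 : (0 : ℝ) < n := by exact_mod_cast hn
  have hs : 0 < Real.sqrt n := Real.sqrt_pos.2 hn0
  have hss : Real.sqrt n ^ 2 = n := Real.sq_sqrt hn0.le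
  have hle : (n.choose l : ℝ) ≤ ∑ k ∈ Finset.Icc l n, (n.choose k : ℝ) :=
    Finset.single_le_sum (f := fun k => (n.choose k : ℝ)) (fun _ _ => by positivity)
      (Finset.mem_Icc.2 ⟨le_rfl, hl⟩)
  have hc : (0 : ℝ) < n.choose l := by exact_mod_cast Nat.choose_pos hl
  have hcs : (∑ k ∈ Finset.Icc l n, (2 * (k : ℝ) - n) * (n.choose k : ℝ)) ^ 2 ≤
      (∑ k ∈ Finset.Icc l n, (2 * (k : ℝ) - n) ^ 2 * (n.choose k : ℝ)) *
        ∑ k ∈ Finset.Icc l n, (n.choose k : ℝ) :=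
    Finset.sum_sq_le_sum_mul_sum_of_sq_le_mul _ (fun _ _ => by positivity)
      (fun _ _ => by positivity) (fun _ _ => le_of_eq (by ring))
  rw [sum_Icc_mul_choose hl] at hcs
  have hsq := sum_Icc_sq_mul_choose_le hl
  set T := ∑ k ∈ Finset.Icc l n, (n.choose k : ℝ)
  have hT : 0 < T := hc.trans_le hle
  set r := (n.choose l : ℝ) / T with hr
  have hrT : (n.choose l : ℝ) = r * T := by rw [hr]; field_simp
  have hr0 : 0 < r := div_pos hc hT
  have hr1 : r ≤ 1 := (div_le_one hT).2 hle
  set d := |(l : ℝ) - (n : ℝ) / 2| with hd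
  have hd0 : 0 ≤ d := abs_nonneg _
  have hrhs : 8 * (d / n + 1 / Real.sqrt n) = 8 * (d + Real.sqrt n) / n := by
    rw [← Real.sqrt_div_self']; ring
  rw [hrhs, le_div_iff₀ hn0]
  by_cases hl4 : (l : ℝ) < n / 4
  · have : n / 4 ≤ d := by linarith [neg_le_abs ((l : ℝ) - (n : ℝ) / 2)]
    nlinarith
  have hquad : (l * r) ^ 2 ≤ 2 * d * (l * r) + 2 * n := by
    have hmul : (l * r) ^ 2 * T ^ 2 ≤ ((2 * (l : ℝ) - n) * (l * r) + 2 * n) * T ^ 2 := by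
      rw [hrT] at hcs hsq
      linarith [mul_le_mul_of_nonneg_right hsq hT.le]
    have hdl : 2 * (l : ℝ) - n ≤ 2 * d := by linarith [le_abs_self ((l : ℝ) - (n : ℝ) / 2)]
    have := mul_le_mul_of_nonneg_right hdl (by positivity : 0 ≤ (l : ℝ) * r)
    linarith [le_of_mul_le_mul_right hmul (by positivity)]
  have hlr : l * r ≤ 2 * d + 2 * Real.sqrt n := by
    by_contra! hlt
    nlinarith [mul_nonneg hd0 hs.le]
  nlinarith
end

section
/- Let n ≥ 1 and let F be an upwards-closed family of subsets of [n], i.e. if F_1 ∈ F and F_1 ⊆ F_2 ⊆ [n] then F_2 ∈ F. For 0 ≤ ℓ ≤ n let F_ℓ := {F ∈ F : |F| = ℓ}. Then for every ℓ with F_ℓ nonempty: |F_ℓ| / (|F_ℓ| + |F_{ℓ+1}| + … + |F_n|) ≤ C(n,ℓ) / Σ_{i=ℓ}^{n} C(n,i). Moreover there is an absolute constant C > 0 (not depending on n, ℓ, or F) such that this common upper bound is at most C·(|ℓ − n/2|/n + 1/√n). -/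
open Finset in
/-- The local LYM inequality for upper shadows. -/
theorem card_mul_choose_succ_le_card_upShadow_mul_choose {n r : ℕ}
    {𝒜 : Finset (Finset (Fin n))} (hr : r < n)
    (h𝒜 : (𝒜 : Set (Finset (Fin n))).Sized r) :
    𝒜.card * n.choose (r + 1) ≤ 𝒜.upShadow.card * n.choose r := by
  have hsized : ((𝒜.compls : Finset (Finset (Fin n))) : Set (Finset (Fin n))).Sized (n - r) := by
    intro s hs
    have hs' := h𝒜 (mem_compls.1 (mem_coe.1 hs))
    rw [card_compl, Fintype.card_fin] at hs'
    have := card_le_univ s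
    rw [Fintype.card_fin] at this
    omega
  have h := local_lubell_yamamoto_meshalkin_inequality_div (𝕜 := ℚ) (by omega) hsized
  rw [shadow_compls, card_compls, card_compls, Fintype.card_fin, Nat.choose_symm hr.le,
    show n - r - 1 = n - (r + 1) by omega, Nat.choose_symm (Nat.succ_le_of_lt hr)] at h
  have h₀ : (0 : ℚ) < n.choose r := by exact_mod_cast Nat.choose_pos hr.le
  have h₁ : (0 : ℚ) < n.choose (r + 1) := by exact_mod_cast Nat.choose_pos hr
  rw [div_le_div_iff₀ h₀ h₁] at h
  exact_mod_cast h

open Finset in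
/-- The density of an upwards-closed family in the levels of the cube is nondecreasing. -/
theorem card_level_mul_choose_le {n ℓ j : ℕ} {F : Finset (Finset (Fin n))}
    (hF : ∀ A ∈ F, ∀ B : Finset (Fin n), A ⊆ B → B ∈ F) (hℓj : ℓ ≤ j) (hj : j ≤ n) :
    (F.filter (fun s => s.card = ℓ)).card * n.choose j ≤
      (F.filter (fun s => s.card = j)).card * n.choose ℓ := by
  induction j, hℓj using Nat.le_induction with
  | base => rfl
  | succ j hℓj ih =>
    have hsized : ((F.filter (fun s => s.card = j) : Finset (Finset (Fin n))) :
        Set (Finset (Fin n))).Sized j := fun s hs => (mem_filter.1 (mem_coe.1 hs)).2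
    have hsub : (F.filter (fun s => s.card = j)).upShadow ⊆
        F.filter (fun s => s.card = j + 1) := by
      intro t ht
      obtain ⟨s, hs, hst, -⟩ := mem_upShadow_iff_exists_mem_card_add_one.1 ht
      exact mem_filter.2 ⟨hF s (mem_filter.1 hs).1 t hst, hsized.upShadow (mem_coe.2 ht)⟩
    have hstep := (card_mul_choose_succ_le_card_upShadow_mul_choose hj hsized).trans
      (Nat.mul_le_mul_right _ (card_le_card hsub))
    refine Nat.le_of_mul_le_mul_right ?_ (Nat.choose_pos (show j ≤ n by omega))
    calc _ = (#{s ∈ F | s.card = ℓ} * n.choose j) * n.choose (j + 1) := by ring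
      _ ≤ (#{s ∈ F | s.card = j} * n.choose ℓ) * n.choose (j + 1) :=
        Nat.mul_le_mul_right _ (ih (by omega))
      _ = (#{s ∈ F | s.card = j} * n.choose (j + 1)) * n.choose ℓ := by ring
      _ ≤ (#{s ∈ F | s.card = j + 1} * n.choose j) * n.choose ℓ := Nat.mul_le_mul_right _ hstep
      _ = _ := by ring

/-- If consecutive binomial coefficients decay at rate at most `1 - δ` on a window of length `m`,
they decay at most linearly over that window. -/
theorem one_sub_mul_choose_le_choose_add {n ℓ m : ℕ} {δ : ℝ} (hδ : 0 ≤ δ) (hm : ℓ + m ≤ n)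
    (hdecay : ∀ j < m, 2 * ((ℓ : ℝ) + j) + 1 - n ≤ δ * (ℓ + j + 1)) {j : ℕ} (hj : j ≤ m) :
    (1 - j * δ) * n.choose ℓ ≤ n.choose (ℓ + j) := by
  induction j with
  | zero => simp
  | succ j ih =>
    have ih := ih (by omega)
    have hd := hdecay j (by omega)
    have hrec : (n.choose (ℓ + j + 1) : ℝ) * (ℓ + j + 1) = n.choose (ℓ + j) * (n - (ℓ + j)) := by
      have := Nat.choose_succ_right_eq n (ℓ + j)
      rw [← Nat.cast_inj (R := ℝ)] at this
      push_cast [Nat.cast_sub (show ℓ + j ≤ n by omega)] at this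
      exact this
    have hpos : (0 : ℝ) < ℓ + j + 1 := by positivity
    have hstep : (1 - δ) * n.choose (ℓ + j) ≤ (n.choose (ℓ + j + 1) : ℝ) := by
      refine le_of_mul_le_mul_right ?_ hpos
      rw [hrec]
      have : (0 : ℝ) ≤ n.choose (ℓ + j) := by positivity
      nlinarith [mul_le_mul_of_nonneg_left hd this]
    rw [← add_assoc]
    push_cast
    have hℓ : (0 : ℝ) ≤ n.choose ℓ := by positivity
    by_cases h1 : δ ≤ 1
    · have hj0 : (0 : ℝ) ≤ j * δ * δ * n.choose ℓ := by positivity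
      nlinarith [mul_le_mul_of_nonneg_left ih (sub_nonneg.2 h1)]
    · have hneg : (1 - ((j : ℝ) + 1) * δ) ≤ 0 := by
        have : (0 : ℝ) ≤ j * δ := by positivity
        linarith
      exact (mul_nonpos_of_nonpos_of_nonneg hneg hℓ).trans (by positivity)

open Finset in
/-- A binomial coefficient is a small fraction of the upper tail that it starts. -/
theorem choose_div_sum_choose_le {n ℓ : ℕ} (hn : 1 ≤ n) (hℓ : ℓ ≤ n) :
    (n.choose ℓ : ℝ) / (∑ i ∈ Icc ℓ n, (n.choose i : ℝ)) ≤
      32 * (|(ℓ : ℝ) - (n : ℝ) / 2| / n + 1 / Real.sqrt n) := by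
  have hc : (0 : ℝ) < n.choose ℓ := by exact_mod_cast Nat.choose_pos hℓ
  have hcS : (n.choose ℓ : ℝ) ≤ ∑ i ∈ Icc ℓ n, (n.choose i : ℝ) :=
    single_le_sum (f := fun i => (n.choose i : ℝ)) (fun _ _ => by positivity)
      (mem_Icc.2 ⟨le_rfl, hℓ⟩)
  rw [div_le_iff₀ (hc.trans_le hcS)]
  have hn0 : (0 : ℝ) < n := by exact_mod_cast hn
  have hs0 : 0 < √(n : ℝ) := Real.sqrt_pos.2 hn0
  have hs2 : √(n : ℝ) * √(n : ℝ) = n := Real.mul_self_sqrt hn0.le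
  set s := √(n : ℝ)
  set t := |(ℓ : ℝ) - (n : ℝ) / 2|
  have ht0 : 0 ≤ t := abs_nonneg _
  have ht1 : (ℓ : ℝ) - n / 2 ≤ t := le_abs_self _
  have ht2 : -((ℓ : ℝ) - n / 2) ≤ t := neg_le_abs _
  set x := t / n + 1 / s with hx
  have htn0 : 0 ≤ t / n := by positivity
  have hs10 : 0 < 1 / s := by positivity
  have hx0 : 0 < x := by positivity
  by_cases hx1 : 1 / 16 < x
  · nlinarith
  push Not at hx1
  set m := ⌊1 / 16 / x⌋₊
  have hm : (m : ℝ) * x ≤ 1 / 16 := (le_div_iff₀ hx0).1 (Nat.floor_le (by positivity))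
  have hm' : 1 / 16 < ((m : ℝ) + 1) * x := (div_lt_iff₀ hx0).1 (Nat.lt_floor_add_one _)
  have hm0 : (0 : ℝ) ≤ m := by positivity
  have htn : t ≤ n / 16 := by
    have : t / n ≤ 1 / 16 := by linarith
    rw [div_le_iff₀ hn0] at this
    linarith
  have hmt : (m : ℝ) * (t / n) ≤ 1 / 16 :=
    (mul_le_mul_of_nonneg_left (by linarith) hm0).trans hm
  have hms : (m : ℝ) / s ≤ 1 / 16 := by
    rw [div_eq_mul_one_div]
    exact (mul_le_mul_of_nonneg_left (by linarith) hm0).trans hm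
  have hmn : (m : ℝ) * (m / n) ≤ 1 / 256 := by
    rw [← hs2, show (m : ℝ) * (m / (s * s)) = (m / s) * (m / s) by field_simp]
    nlinarith [div_nonneg hm0 hs0.le]
  have hs1 : 1 ≤ s := Real.one_le_sqrt.2 (by exact_mod_cast hn)
  have hmle : (m : ℝ) ≤ n / 16 := by
    rw [div_le_iff₀ hs0] at hms
    nlinarith
  have hℓm : ℓ + m ≤ n := by
    have : (ℓ : ℝ) + m ≤ n := by linarith
    exact_mod_cast this
  have hwindow : ∀ j ∈ Icc ℓ (ℓ + m), (n.choose ℓ : ℝ) / 2 ≤ n.choose j := by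
    intro j hj
    obtain ⟨k, rfl⟩ := Nat.exists_eq_add_of_le (mem_Icc.1 hj).1
    have hk : k ≤ m := by have := (mem_Icc.1 hj).2; omega
    have hkm : (k : ℝ) ≤ m := by exact_mod_cast hk
    have hδ : 0 ≤ 5 * (t / n + m / n) := by positivity
    refine le_trans ?_ (one_sub_mul_choose_le_choose_add hδ hℓm ?_ hk)
    · have := mul_le_mul_of_nonneg_right hkm hδ
      nlinarith
    · intro i hi
      have him : (i : ℝ) + 1 ≤ m := by exact_mod_cast hi
      have hi0 : (0 : ℝ) ≤ i := by positivity
      have hlow : (7 / 16 : ℝ) * n ≤ ℓ + i + 1 := by linarith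
      calc 2 * ((ℓ : ℝ) + i) + 1 - n ≤ 5 * (7 / 16) * (t + m) := by linarith
        _ = 5 * (t / n + m / n) * (7 / 16 * n) := by field_simp
        _ ≤ _ := mul_le_mul_of_nonneg_left hlow hδ
  have hsum : ((m : ℝ) + 1) * (n.choose ℓ / 2) ≤ ∑ i ∈ Icc ℓ n, (n.choose i : ℝ) := by
    calc ((m : ℝ) + 1) * (n.choose ℓ / 2) = ∑ _i ∈ Icc ℓ (ℓ + m), (n.choose ℓ : ℝ) / 2 := by
          rw [sum_const, Nat.card_Icc, nsmul_eq_mul, show ℓ + m + 1 - ℓ = m + 1 by omega]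
          push_cast
          rfl
      _ ≤ ∑ i ∈ Icc ℓ (ℓ + m), (n.choose i : ℝ) := sum_le_sum hwindow
      _ ≤ _ := sum_le_sum_of_subset_of_nonneg (Icc_subset_Icc_right hℓm)
          fun _ _ _ => by positivity
  nlinarith [mul_le_mul_of_nonneg_left hsum hx0.le]

/-- For `n ≥ 1` and an upwards-closed family `F` of subsets of `[n]`,
with `F_ℓ` the sets in `F` of size `ℓ`: if `F_ℓ ≠ ∅` then
`|F_ℓ| / (|F_ℓ| + … + |F_n|) ≤ C(n,ℓ) / Σ_{i=ℓ}^n C(n,i)`, and there is an absolute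
constant `C > 0` with `C(n,ℓ) / Σ_{i=ℓ}^n C(n,i) ≤ C·(|ℓ − n/2|/n + 1/√n)`. -/
theorem upwards_closed_level_ratio :
    ∃ C : ℝ, 0 < C ∧
      ∀ n : ℕ, 1 ≤ n →
        ∀ F : Finset (Finset (Fin n)),
          (∀ A ∈ F, ∀ B : Finset (Fin n), A ⊆ B → B ∈ F) →
          ∀ ℓ : ℕ, ℓ ≤ n → (F.filter (fun s => s.card = ℓ)).Nonempty →
            ((F.filter (fun s => s.card = ℓ)).card : ℝ) /
                (∑ j ∈ Finset.Icc ℓ n, ((F.filter (fun s => s.card = j)).card : ℝ))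
              ≤ (n.choose ℓ : ℝ) / (∑ i ∈ Finset.Icc ℓ n, (n.choose i : ℝ)) ∧
            (n.choose ℓ : ℝ) / (∑ i ∈ Finset.Icc ℓ n, (n.choose i : ℝ))
              ≤ C * (|(ℓ : ℝ) - (n : ℝ) / 2| / n + 1 / Real.sqrt n) := by
  refine ⟨32, by norm_num, fun n hn F hF ℓ hℓ hne => ⟨?_, choose_div_sum_choose_le hn hℓ⟩⟩
  have hmem : ℓ ∈ Finset.Icc ℓ n := Finset.mem_Icc.2 ⟨le_rfl, hℓ⟩
  have hlevels : (0 : ℝ) <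
      ∑ j ∈ Finset.Icc ℓ n, ((F.filter (fun s => s.card = j)).card : ℝ) :=
    Finset.sum_pos' (fun _ _ => by positivity) ⟨ℓ, hmem, by exact_mod_cast hne.card_pos⟩
  have hbinom : (0 : ℝ) < ∑ i ∈ Finset.Icc ℓ n, (n.choose i : ℝ) :=
    Finset.sum_pos' (fun _ _ => by positivity) ⟨ℓ, hmem, by exact_mod_cast Nat.choose_pos hℓ⟩
  rw [div_le_div_iff₀ hlevels hbinom, Finset.mul_sum, Finset.mul_sum]
  refine Finset.sum_le_sum fun j hj => ?_
  rw [mul_comm (n.choose ℓ : ℝ)]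
  have hj := Finset.mem_Icc.1 hj
  exact_mod_cast card_level_mul_choose_le hF hj.1 hj.2
end
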